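/- Let T ⊆ E be a set of directed edges such that: every vertex incident to a T-edge other than s has exactly one incoming T-edge; s has no incoming T-edge; T has no directed cycles; every destination k ∈ D is reachable from s along T-edges; and the unique T-parent of each destination is not a destination. Define g : V → V → ℝ by g i j := max({x k : k ∈ D, j = k or k is reachable from j along T-edges} ∪ {0}) if (i,j) ∈ T, and g i j := 0 otherwise. Then g is a feasible flow. (The canonical tree flow that assigns to each tree edge the maximum downstream demand satisfies all constraints of the minimum-flow problem.) -/

import Mathlib

noncomputable section

open scoped Classical

/-- `out(f,i)`: the maximum outflow value of node `i`, taken over the finite node type. -/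
def flowOut {V : Type*} [Fintype V] [Nonempty V] (f : V → V → ℝ) (i : V) : ℝ :=
  Finset.univ.sup' Finset.univ_nonempty (fun j => f i j)

/-- `in(f,i)`: the maximum inflow value of node `i`, taken over the finite node type. -/
def flowIn {V : Type*} [Fintype V] [Nonempty V] (f : V → V → ℝ) (i : V) : ℝ :=
  Finset.univ.sup' Finset.univ_nonempty (fun j => f j i)

/-- Feasibility of a flow `f` for the minimum-flow multicast problem:
(N) nonnegativity, (S) support confined to the edge set `E`,
(C1) out ≤ in at every non-source node, (C2) the source outflow covers the
largest demand, (C3) each destination `j ∈ D` receives at least `x j` from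
some non-destination node. -/
def Feasible {V : Type*} [Fintype V] [Nonempty V] [DecidableEq V]
    (E : Set (V × V)) (s : V) (D : Finset V)
    (hD : D.Nonempty) (hsD : s ∉ D) (x : V → ℝ) (f : V → V → ℝ) : Prop :=
  (∀ i j, 0 ≤ f i j) ∧
  (∀ i j, (i, j) ∉ E → f i j = 0) ∧
  (∀ i, i ≠ s → flowOut f i ≤ flowIn f i) ∧
  (D.sup' hD x ≤ flowOut f s) ∧
  (∀ j ∈ D, x j ≤ (Finset.univ \ D).sup'
      ⟨s, Finset.mem_sdiff.mpr ⟨Finset.mem_univ s, hsD⟩⟩ (fun i => f i j))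

/-- Total transmission cost of a flow. -/
def cost {V : Type*} [Fintype V] (e f : V → V → ℝ) : ℝ :=
  ∑ i, ∑ j, e i j * f i j

/-- Maximum downstream demand below node `j` along `T`-edges:
`max ({x k : k ∈ D, j = k or k reachable from j along T} ∪ {0})`. -/
noncomputable def mval {V : Type*} (T : Set (V × V)) (D : Finset V) (x : V → ℝ) (j : V) : ℝ :=
  (D.filter (fun k => j = k ∨ Relation.ReflTransGen (fun a b => (a, b) ∈ T) j k)).fold max 0 x

/-- The canonical tree flow: each tree edge `(i,j) ∈ T` carries the maximum
downstream demand below `j`; all other pairs carry zero flow. -/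
noncomputable def treeFlow {V : Type*} (T : Set (V × V)) (D : Finset V) (x : V → ℝ) :
    V → V → ℝ :=
  fun i j => if (i, j) ∈ T then mval T D x j else 0

theorem mval_nonneg {V : Type*} (T : Set (V × V)) (D : Finset V) (x : V → ℝ) (j : V) :
    0 ≤ mval T D x j :=
  Finset.le_fold_max 0 |>.mpr (Or.inl le_rfl)

theorem le_mval {V : Type*} {T : Set (V × V)} {D : Finset V} (x : V → ℝ) {j k : V} (hk : k ∈ D)
    (hjk : Relation.ReflTransGen (fun a b => (a, b) ∈ T) j k) : x k ≤ mval T D x j :=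
  Finset.le_fold_max (x k) |>.mpr
    (Or.inr ⟨k, Finset.mem_filter.mpr ⟨hk, Or.inr hjk⟩, le_rfl⟩)

theorem mval_le_mval_of_mem {V : Type*} {T : Set (V × V)} (D : Finset V) (x : V → ℝ) {i j : V}
    (hij : (i, j) ∈ T) : mval T D x j ≤ mval T D x i := by
  refine (Finset.fold_max_le _).mpr ⟨mval_nonneg T D x i, fun k hk => ?_⟩
  obtain ⟨hkD, hjk⟩ := Finset.mem_filter.mp hk
  refine le_mval x hkD (Relation.ReflTransGen.head hij ?_)
  rcases hjk with rfl | h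
  · exact .refl
  · exact h

theorem treeFlow_of_mem {V : Type*} {T : Set (V × V)} (D : Finset V) (x : V → ℝ) {i j : V}
    (h : (i, j) ∈ T) : treeFlow T D x i j = mval T D x j :=
  if_pos h

theorem treeFlow_of_notMem {V : Type*} {T : Set (V × V)} (D : Finset V) (x : V → ℝ) {i j : V}
    (h : (i, j) ∉ T) : treeFlow T D x i j = 0 :=
  if_neg h

theorem treeFlow_nonneg {V : Type*} (T : Set (V × V)) (D : Finset V) (x : V → ℝ) (i j : V) :
    0 ≤ treeFlow T D x i j := by
  by_cases h : (i, j) ∈ T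
  · exact (mval_nonneg T D x j).trans_eq (treeFlow_of_mem D x h).symm
  · exact (treeFlow_of_notMem D x h).ge

theorem le_flowOut {V : Type*} [Fintype V] [Nonempty V] (f : V → V → ℝ) (i j : V) :
    f i j ≤ flowOut f i :=
  Finset.le_sup' (fun j => f i j) (Finset.mem_univ j)

theorem le_flowIn {V : Type*} [Fintype V] [Nonempty V] (f : V → V → ℝ) (i j : V) :
    f j i ≤ flowIn f i :=
  Finset.le_sup' (fun j => f j i) (Finset.mem_univ j)

/-- the canonical tree flow on a rooted tree `T ⊆ E` reaching
all destinations (with non-destination parents of destinations) is feasible. -/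
theorem treeFlow_feasible {V : Type*} [Fintype V] [Nonempty V] [DecidableEq V]
    (E : Set (V × V)) (e : V → V → ℝ) (s : V) (D : Finset V)
    (hD : D.Nonempty) (hsD : s ∉ D) (x : V → ℝ) (hx : ∀ k ∈ D, 0 < x k)
    (T : Set (V × V)) (hTE : T ⊆ E)
    (hIncoming : ∀ v, v ≠ s → (∃ w, (v, w) ∈ T ∨ (w, v) ∈ T) → ∃! u, (u, v) ∈ T)
    (hsIn : ∀ u, (u, s) ∉ T)
    (hTAcyc : ¬ ∃ v, Relation.TransGen (fun a b => (a, b) ∈ T) v v)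
    (hReach : ∀ k ∈ D, Relation.ReflTransGen (fun a b => (a, b) ∈ T) s k)
    (hParent : ∀ k ∈ D, ∀ u, (u, k) ∈ T → u ∉ D) :
    Feasible E s D hD hsD x (treeFlow T D x) := by
  refine ⟨treeFlow_nonneg T D x, fun i j hij => treeFlow_of_notMem D x fun h => hij (hTE h),
    fun i hi => ?_, ?_, fun k hk => ?_⟩
  · refine Finset.sup'_le _ _ fun j _ => ?_
    by_cases hij : (i, j) ∈ T
    · obtain ⟨u, hu, -⟩ := hIncoming i hi ⟨j, Or.inl hij⟩
      calc treeFlow T D x i j = mval T D x j := treeFlow_of_mem D x hij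
        _ ≤ mval T D x i := mval_le_mval_of_mem D x hij
        _ = treeFlow T D x u i := (treeFlow_of_mem D x hu).symm
        _ ≤ flowIn (treeFlow T D x) i := le_flowIn _ i u
    · rw [treeFlow_of_notMem D x hij]
      exact (treeFlow_nonneg T D x i i).trans (le_flowIn _ i i)
  · refine Finset.sup'_le _ _ fun k hk => ?_
    rcases (hReach k hk).cases_head with rfl | ⟨j, hsj, hjk⟩
    · exact absurd hk hsD
    · calc x k ≤ mval T D x j := le_mval x hk hjk
        _ = treeFlow T D x s j := (treeFlow_of_mem D x hsj).symm
        _ ≤ flowOut (treeFlow T D x) s := le_flowOut _ s j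
  · rcases (hReach k hk).cases_tail with rfl | ⟨u, -, huk⟩
    · exact absurd hk hsD
    · calc x k ≤ mval T D x k := le_mval x hk .refl
        _ = treeFlow T D x u k := (treeFlow_of_mem D x huk).symm
        _ ≤ _ := Finset.le_sup' (fun i => treeFlow T D x i k)
            (Finset.mem_sdiff.mpr ⟨Finset.mem_univ u, hParent k hk u huk⟩)
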